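/- arXiv:2503.16370 — 4 statements merged into one kernel-verified Lean document; each statement's English description precedes it below -/
import Mathlib

section
/- Let U, V, W be finite-dimensional real inner product spaces, Ω ⊆ U × V × W an open neighborhood of the origin, and S : Ω × ℝ → ℝ a smooth function satisfying (NF0) and (NF1). Define λ(t) := −L₀^{-1}(∇_u S₁(0,0,t)) and S'₀(t) := (1/2)⟨∇_u S₁(0,0,t), λ(t)⟩ + S₂(0,0,t) for t in a neighborhood of 0 in W. If the Fréchet derivative of S'₀ at 0 is nonzero (i.e. 0 is not a critical point of S'₀), then there exist an open neighborhood 𝒰₀ ⊆ Ω of the origin and a constant ε₀ > 0 such that for every ε with 0 < |ε| < ε₀ the function S(·,ε) has no critical points in 𝒰₀. -/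
open scoped RealInnerProductSpace

open Filter Topology Asymptotics

section DirectionalDerivative

variable {E : Type*} [NormedAddCommGroup E] [NormedSpace ℝ E]

/-- The derivative of `f` in the constant direction `a`. -/
noncomputable def dirDeriv (a : E) (f : E → ℝ) (x : E) : ℝ := fderiv ℝ f x a

theorem ContDiffOn.dirDeriv_of_isOpen {f : E → ℝ} {O : Set E} (hf : ContDiffOn ℝ (⊤ : ℕ∞) f O)
    (hO : IsOpen O) (a : E) : ContDiffOn ℝ (⊤ : ℕ∞) (dirDeriv a f) O :=
  (hf.fderiv_of_isOpen (m := (⊤ : ℕ∞)) hO (by simp)).clm_apply contDiffOn_const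

theorem dirDeriv_congr {f g : E → ℝ} {O : Set E} (hO : IsOpen O) (h : Set.EqOn f g O) (a : E) :
    Set.EqOn (dirDeriv a f) (dirDeriv a g) O := fun x hx => by
  have : f =ᶠ[𝓝 x] g := h.eventuallyEq_of_mem (hO.mem_nhds hx)
  simp only [dirDeriv, this.fderiv_eq]

theorem dirDeriv_comm {f : E → ℝ} {O : Set E} (hf : ContDiffOn ℝ (⊤ : ℕ∞) f O)
    (hO : IsOpen O) (a b : E) :
    Set.EqOn (dirDeriv a (dirDeriv b f)) (dirDeriv b (dirDeriv a f)) O := fun x hx => by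
  have hfx : ContDiffAt ℝ (⊤ : ℕ∞) f x := hf.contDiffAt (hO.mem_nhds hx)
  have hd : DifferentiableAt ℝ (fderiv ℝ f) x :=
    (hfx.fderiv_right (m := (⊤ : ℕ∞)) (by simp)).differentiableAt (by simp)
  have key (c d : E) : dirDeriv c (dirDeriv d f) x = fderiv ℝ (fderiv ℝ f) x c d := by
    have : HasFDerivAt (dirDeriv d f) ((fderiv ℝ (fderiv ℝ f) x).flip d) x := by
      have h := hd.hasFDerivAt.clm_apply (hasFDerivAt_const d x)
      rw [ContinuousLinearMap.comp_zero, zero_add] at h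
      exact h
    simp [dirDeriv, this.fderiv]
  rw [key, key]
  exact (hfx.isSymmSndFDerivAt (by
    rw [minSmoothness_of_isRCLikeNormedField]; exact WithTop.coe_le_coe.2 (le_top : (2 : ℕ∞) ≤ ⊤))) a b

theorem ContDiffOn.hasStrictFDerivAt_of_isOpen {f : E → ℝ} {O : Set E}
    (hf : ContDiffOn ℝ (⊤ : ℕ∞) f O) (hO : IsOpen O) {x : E} (hx : x ∈ O) :
    HasStrictFDerivAt f (fderiv ℝ f x) x :=
  (hf.contDiffAt (hO.mem_nhds hx)).hasStrictFDerivAt (by simp)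

end DirectionalDerivative

section Expansion

variable {X : Type*} [NormedAddCommGroup X] [NormedSpace ℝ X]

theorem deriv_param_eq_dirDeriv {f : X × ℝ → ℝ} {x : X} {e : ℝ} (hf : DifferentiableAt ℝ f (x, e)) :
    deriv (fun s => f (x, s)) e = dirDeriv (0, 1) f (x, e) :=
  (hf.hasFDerivAt.comp_hasDerivAt e ((hasDerivAt_const e x).prodMk (hasDerivAt_id e))).deriv

theorem fderiv_slice_apply {f : X × ℝ → ℝ} {x : X} {e : ℝ} (hf : DifferentiableAt ℝ f (x, e)) (a : X) :
    fderiv ℝ (fun y => f (y, e)) x a = dirDeriv (a, 0) f (x, e) := by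
  have h : HasFDerivAt (fun y => f (y, e)) _ x :=
    HasFDerivAt.comp (f := fun y : X => (y, e)) x hf.hasFDerivAt (hasFDerivAt_prodMk_left x e)
  rw [h.fderiv]
  simp [dirDeriv]

/-- First order expansion in the parameter, uniformly in the base point. -/
theorem HasStrictFDerivAt.sub_param_isLittleO {f : X × ℝ → ℝ} {f' : X × ℝ →L[ℝ] ℝ}
    (hf : HasStrictFDerivAt f f' 0) :
    (fun x : X × ℝ => f x - f (x.1, 0) - x.2 * f' (0, 1)) =o[𝓝 0] (fun x => x.2) := by
  have ht : Tendsto (fun x : X × ℝ => (x, ((x.1, 0) : X × ℝ))) (𝓝 0) (𝓝 (0, 0)) := by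
    have : Continuous (fun x : X × ℝ => (x, ((x.1, 0) : X × ℝ))) := by fun_prop
    exact this.tendsto' _ _ rfl
  have h := hf.isLittleO.comp_tendsto ht
  refine (h.congr_left fun x => ?_).trans_isBigO (IsBigO.of_bound 1 (.of_forall fun x => ?_))
  · have : x - (x.1, 0) = x.2 • ((0, 1) : X × ℝ) := by ext <;> simp
    simp only [Function.comp, this, map_smul, smul_eq_mul]
  · have : x - (x.1, 0) = ((0, x.2) : X × ℝ) := by ext <;> simp
    simp [this, Prod.norm_def, -Real.norm_eq_abs]

/-- Second order expansion in the parameter, uniformly in the base point. -/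
theorem ContDiffOn.sub_param_isLittleO_sq {f : X × ℝ → ℝ} {O : Set (X × ℝ)}
    (hf : ContDiffOn ℝ (⊤ : ℕ∞) f O) (hO : IsOpen O) (h0 : 0 ∈ O) :
    (fun x : X × ℝ => f x - f (x.1, 0) - x.2 * dirDeriv (0, 1) f (x.1, 0)
      - x.2 ^ 2 * (dirDeriv (0, 1) (dirDeriv (0, 1) f) 0 / 2)) =o[𝓝 0] (fun x => x.2 ^ 2) := by
  set A := dirDeriv (0, 1) (dirDeriv (0, 1) f) 0
  have hs := ((hf.dirDeriv_of_isOpen hO (0, 1)).hasStrictFDerivAt_of_isOpen hO h0).sub_param_isLittleO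
  refine IsLittleO.of_bound fun δ hδ => ?_
  obtain ⟨r, hr, hball⟩ := Metric.eventually_nhds_iff_ball.1 ((hs.bound hδ).and (hO.mem_nhds h0))
  filter_upwards [Metric.ball_mem_nhds 0 hr] with ⟨p, ε⟩ hx
  have hmem : ∀ s ∈ Metric.closedBall (0 : ℝ) |ε|, (p, s) ∈ Metric.ball (0 : X × ℝ) r := by
    intro s hs
    simp only [Metric.mem_ball, dist_zero_right, Prod.norm_def, Metric.mem_closedBall,
      Real.norm_eq_abs, sup_lt_iff] at hx hs ⊢
    exact ⟨hx.1, hs.trans_lt hx.2⟩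
  let k : ℝ → ℝ := fun s => f (p, s) - f (p, 0) - s * dirDeriv (0, 1) f (p, 0) - s ^ 2 * (A / 2)
  have hk : ∀ s ∈ Metric.closedBall (0 : ℝ) |ε|, HasDerivWithinAt k
      (dirDeriv (0, 1) f (p, s) - dirDeriv (0, 1) f (p, 0) - s * A)
      (Metric.closedBall (0 : ℝ) |ε|) s := by
    intro s hs
    have h1 : HasDerivAt (fun s : ℝ => f (p, s)) (dirDeriv (0, 1) f (p, s)) s :=
      (hf.hasStrictFDerivAt_of_isOpen hO (hball _ (hmem s hs)).2).hasFDerivAt.comp_hasDerivAt s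
        ((hasDerivAt_const s p).prodMk (hasDerivAt_id s))
    have h2 := ((h1.sub_const (f (p, 0))).sub
      ((hasDerivAt_id s).mul_const (dirDeriv (0, 1) f (p, 0)))).sub
      (((hasDerivAt_id s).pow 2).mul_const (A / 2))
    refine (h2.congr_deriv ?_).hasDerivWithinAt
    simp
    ring
  have hbound : ∀ s ∈ Metric.closedBall (0 : ℝ) |ε|,
      ‖dirDeriv (0, 1) f (p, s) - dirDeriv (0, 1) f (p, 0) - s * A‖ ≤ δ * |ε| := by
    intro s hs
    refine ((hball _ (hmem s hs)).1).trans ?_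
    have : |s| ≤ |ε| := by simpa using hs
    exact mul_le_mul_of_nonneg_left this hδ.le
  have := (convex_closedBall (0 : ℝ) |ε|).norm_image_sub_le_of_norm_hasDerivWithin_le hk hbound
    (x := 0) (y := ε) (by simp) (by simp)
  have hk0 : k 0 = 0 := by simp [k]
  rw [hk0, sub_zero, sub_zero, Real.norm_eq_abs ε, mul_assoc, ← pow_two, sq_abs] at this
  simpa [k] using this

end Expansion

theorem tendsto_of_forall_inner {α U : Type*} [NormedAddCommGroup U] [InnerProductSpace ℝ U]
    [FiniteDimensional ℝ U] {l : Filter α} {f : α → U} {x : U}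
    (h : ∀ a : U, Tendsto (fun i => ⟪a, f i⟫) l (𝓝 ⟪a, x⟫)) : Tendsto f l (𝓝 x) := by
  have hb := (stdOrthonormalBasis ℝ U).sum_repr'
  rw [← hb x]
  exact (tendsto_finsetSum _ fun i _ => (h _).smul_const _).congr fun i => hb (f i)

section NormalForm

variable {U V W : Type*} [NormedAddCommGroup U] [InnerProductSpace ℝ U]
  [NormedAddCommGroup V] [InnerProductSpace ℝ V]
  [NormedAddCommGroup W] [InnerProductSpace ℝ W]
  {Ω : Set (U × V × W)} {S : (U × V × W) × ℝ → ℝ}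

/-- The first variation of the unperturbed normal form. -/
theorem dirDeriv_of_quadratic [FiniteDimensional ℝ U] (hΩ : IsOpen Ω)
    (hS : ContDiffOn ℝ (⊤ : ℕ∞) S (Ω ×ˢ Set.univ))
    (L₀ : U ≃ₗ[ℝ] U) (hL₀ : ∀ x y : U, ⟪L₀ x, y⟫ = ⟪x, L₀ y⟫) (c₀ : ℝ)
    (hNF0 : ∀ p ∈ Ω, S (p, 0) = (1 / 2) * ⟪L₀ p.1, p.1⟫ + c₀)
    {p : U × V × W} (hp : p ∈ Ω) (a : U × V × W) :
    dirDeriv (a, 0) S (p, 0) = ⟪L₀ p.1, a.1⟫ := by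
  have hO : IsOpen (Ω ×ˢ (Set.univ : Set ℝ)) := hΩ.prod isOpen_univ
  rw [← fderiv_slice_apply
    (hS.hasStrictFDerivAt_of_isOpen hO (x := (p, 0)) ⟨hp, trivial⟩).differentiableAt]
  have he : (fun y => S (y, 0)) =ᶠ[𝓝 p] fun y => (1 / 2) * ⟪L₀ y.1, y.1⟫ + c₀ := by
    filter_upwards [hΩ.mem_nhds hp] with y hy using hNF0 y hy
  rw [he.fderiv_eq]
  let L : U →L[ℝ] U := L₀.toLinearMap.toContinuousLinearMap
  have h1 : HasFDerivAt (fun y : U × V × W => y.1) (ContinuousLinearMap.fst ℝ U (V × W)) p :=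
    hasFDerivAt_fst
  have h2 := (((L.hasFDerivAt.comp p h1).inner ℝ h1).const_mul (1 / 2)).add_const c₀
  have h3 : HasFDerivAt (fun y : U × V × W => (1 / 2) * ⟪L₀ y.1, y.1⟫ + c₀) _ p := h2
  rw [h3.fderiv]
  have h4 : ⟪L₀ a.1, p.1⟫ = ⟪L₀ p.1, a.1⟫ := by rw [hL₀, real_inner_comm]
  simp [L, fderivInnerCLM_apply, h4]
  ring

/-- The rescaled `U`-component of a family of critical points converges to `λ(0)`. -/
theorem tendsto_inv_smul_of_critical [FiniteDimensional ℝ U] (hΩ : IsOpen Ω)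
    (hΩ0 : (0 : U × V × W) ∈ Ω)
    (hS : ContDiffOn ℝ (⊤ : ℕ∞) S (Ω ×ˢ Set.univ))
    (L₀ : U ≃ₗ[ℝ] U) (hL₀ : ∀ x y : U, ⟪L₀ x, y⟫ = ⟪x, L₀ y⟫) (c₀ : ℝ)
    (hNF0 : ∀ p ∈ Ω, S (p, 0) = (1 / 2) * ⟪L₀ p.1, p.1⟫ + c₀) (g₀ : U)
    (hg₀ : ∀ a : U, ⟪g₀, a⟫ = dirDeriv ((a, 0, 0), 0) (dirDeriv (0, 1) S) 0)
    {l : Filter ((U × V × W) × ℝ)} (hl : l ≤ 𝓝 0) (hne : ∀ᶠ x in l, x.2 ≠ 0)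
    (hcrit : ∀ᶠ x in l, ∀ a : U × V × W, dirDeriv (a, 0) S x = 0) :
    Tendsto (fun x => x.2⁻¹ • x.1.1) l (𝓝 (-(L₀.symm g₀))) := by
  have hO : IsOpen (Ω ×ˢ (Set.univ : Set ℝ)) := hΩ.prod isOpen_univ
  have h0 : (0 : (U × V × W) × ℝ) ∈ Ω ×ˢ (Set.univ : Set ℝ) := ⟨hΩ0, trivial⟩
  have hΩl : ∀ᶠ x in l, x.1 ∈ Ω := by
    filter_upwards [hl (hO.mem_nhds h0)] with x hx using hx.1
  refine tendsto_of_forall_inner fun a => ?_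
  obtain ⟨b, rfl⟩ := L₀.surjective a
  have hexp := (((hS.dirDeriv_of_isOpen hO ((b, 0, 0), 0)).hasStrictFDerivAt_of_isOpen
    hO h0).sub_param_isLittleO.mono hl).tendsto_div_nhds_zero
  have hA : fderiv ℝ (dirDeriv ((b, 0, 0), 0) S) 0 (0, 1) = ⟪g₀, b⟫ := by
    rw [hg₀]
    exact dirDeriv_comm hS hO _ _ h0
  have hlim : ⟪L₀ b, -(L₀.symm g₀)⟫ = -0 - ⟪g₀, b⟫ := by
    rw [hL₀, map_neg, L₀.apply_symm_apply, inner_neg_right, real_inner_comm]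
    ring
  rw [hlim]
  refine (hexp.neg.sub_const ⟪g₀, b⟫).congr' ?_
  filter_upwards [hne, hcrit, hΩl] with x hx hc hxΩ
  rw [hA, hc, dirDeriv_of_quadratic hΩ hS L₀ hL₀ c₀ hNF0 hxΩ, inner_smul_right, hL₀ b,
    real_inner_comm]
  field_simp
  ring

/-- The leading order of the equation in the direction `t ∈ W` at critical points. -/
theorem leading_term_eq_zero_of_critical (hΩ : IsOpen Ω) (hΩ0 : (0 : U × V × W) ∈ Ω)
    (hS : ContDiffOn ℝ (⊤ : ℕ∞) S (Ω ×ˢ Set.univ)) (t : W)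
    (hS0 : ∀ p ∈ Ω, dirDeriv ((0, 0, t), 0) S (p, 0) = 0)
    (hS1 : ∀ v w, ((0, v, w) : U × V × W) ∈ Ω →
      dirDeriv (0, 1) (dirDeriv ((0, 0, t), 0) S) ((0, v, w), 0) = 0) (u₀ : U)
    {l : Filter ((U × V × W) × ℝ)} [l.NeBot] (hl : l ≤ 𝓝 0) (hne : ∀ᶠ x in l, x.2 ≠ 0)
    (hcrit : ∀ᶠ x in l, ∀ a : U × V × W, dirDeriv (a, 0) S x = 0)
    (hu : Tendsto (fun x => x.2⁻¹ • x.1.1) l (𝓝 u₀)) :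
    dirDeriv ((u₀, 0, 0), 0) (dirDeriv (0, 1) (dirDeriv ((0, 0, t), 0) S)) 0
      + dirDeriv (0, 1) (dirDeriv (0, 1) (dirDeriv ((0, 0, t), 0) S)) 0 / 2 = 0 := by
  have hO : IsOpen (Ω ×ˢ (Set.univ : Set ℝ)) := hΩ.prod isOpen_univ
  have h0 : (0 : (U × V × W) × ℝ) ∈ Ω ×ˢ (Set.univ : Set ℝ) := ⟨hΩ0, trivial⟩
  have hh := hS.dirDeriv_of_isOpen hO ((0, 0, t), 0)
  set H := dirDeriv (0, 1) (dirDeriv ((0, 0, t), 0) S) with hHdef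
  have hH := (hh.dirDeriv_of_isOpen hO (0, 1)).hasStrictFDerivAt_of_isOpen hO h0
  rw [← hHdef] at hH
  have hsq := ((hh.sub_param_isLittleO_sq hO h0).mono hl).tendsto_div_nhds_zero
  rw [← hHdef] at hsq
  set A := dirDeriv (0, 1) H 0
  let B : U →L[ℝ] ℝ := (fderiv ℝ H 0).comp
    ((ContinuousLinearMap.inl ℝ (U × V × W) ℝ).comp (ContinuousLinearMap.inl ℝ U (V × W)))
  have hbig : (fun x : (U × V × W) × ℝ => x.1.1) =O[l] fun x => x.2 := by
    have h1 := (isBigO_refl (fun x : (U × V × W) × ℝ => x.2) l).smul (hu.isBigO_one ℝ)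
    refine (h1.congr' ?_ (.of_forall fun x => by simp))
    filter_upwards [hne] with x hx
    simp [smul_smul, hx]
  have hfirst : (fun x : (U × V × W) × ℝ => H (x.1, 0) - H ((0, x.1.2), 0) - B x.1.1)
      =o[l] fun x => x.2 := by
    have ht : Tendsto (fun x : (U × V × W) × ℝ => (((x.1, 0) : (U × V × W) × ℝ),
        (((0, x.1.2), 0) : (U × V × W) × ℝ))) l (𝓝 (0, 0)) := by
      have : Continuous (fun x : (U × V × W) × ℝ => (((x.1, 0) : (U × V × W) × ℝ),
        (((0, x.1.2), 0) : (U × V × W) × ℝ))) := by fun_prop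
      exact (this.tendsto' 0 _ rfl).mono_left hl
    have h := hH.isLittleO.comp_tendsto ht
    refine ((h.congr_left fun x => ?_).trans_isBigO
      (IsBigO.of_bound 1 (.of_forall fun x => ?_))).trans_isBigO hbig
    · have : ((x.1, 0) : (U × V × W) × ℝ) - ((0, x.1.2), 0) = ((x.1.1, 0), 0) := by
        ext <;> simp
      simp [B, this, -map_sub]
    · simp [Prod.norm_def]
  have hcont : ∀ᶠ x in l, (x.1 ∈ Ω ∧ ((0, x.1.2) : U × V × W) ∈ Ω) := by
    have hc : Continuous (fun x : (U × V × W) × ℝ => ((0, x.1.2) : U × V × W)) := by fun_prop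
    have hc' : Tendsto (fun x : (U × V × W) × ℝ => ((0, x.1.2) : U × V × W)) (𝓝 0) (𝓝 0) :=
      hc.tendsto' 0 _ rfl
    filter_upwards [hl (hO.mem_nhds h0), hl (hc' (hΩ.mem_nhds hΩ0))] with x hx hx'
    exact ⟨hx.1, hx'⟩
  have hlim := (hsq.add hfirst.tendsto_div_nhds_zero).add
    (((B.continuous.tendsto _).comp hu).add_const (A / 2))
  have hzero := tendsto_nhds_unique_of_eventuallyEq hlim (tendsto_const_nhds (x := (0 : ℝ))) (by
    filter_upwards [hne, hcrit, hcont] with x hx hc hxΩ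
    simp only [Function.comp, map_smul, smul_eq_mul]
    rw [hc, hS0 _ hxΩ.1, hS1 _ _ hxΩ.2]
    field_simp
    ring)
  rw [zero_add, zero_add] at hzero
  exact hzero

/-- The derivative of the leading term `S'₀` at `0`. -/
theorem fderiv_leading_term [FiniteDimensional ℝ U] (hΩ : IsOpen Ω) (hΩ0 : (0 : U × V × W) ∈ Ω)
    (hS : ContDiffOn ℝ (⊤ : ℕ∞) S (Ω ×ˢ Set.univ))
    (L₀ : U ≃ₗ[ℝ] U) (hL₀ : ∀ x y : U, ⟪L₀ x, y⟫ = ⟪x, L₀ y⟫) (g : W → U)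
    (hg : ∀ᶠ t in 𝓝 0, ∀ a : U,
      ⟪g t, a⟫ = dirDeriv ((a, 0, 0), 0) (dirDeriv (0, 1) S) ((0, 0, t), 0))
    (S₀' : W → ℝ)
    (hS₀' : ∀ᶠ t in 𝓝 0, S₀' t = (1 / 2) * ⟪g t, -(L₀.symm (g t))⟫
      + (1 / 2) * dirDeriv (0, 1) (dirDeriv (0, 1) S) ((0, 0, t), 0)) (t : W) :
    fderiv ℝ S₀' 0 t =
      dirDeriv ((-(L₀.symm (g 0)), 0, 0), 0) (dirDeriv (0, 1) (dirDeriv ((0, 0, t), 0) S)) 0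
      + dirDeriv (0, 1) (dirDeriv (0, 1) (dirDeriv ((0, 0, t), 0) S)) 0 / 2 := by
  have hO : IsOpen (Ω ×ˢ (Set.univ : Set ℝ)) := hΩ.prod isOpen_univ
  have h0 : (0 : (U × V × W) × ℝ) ∈ Ω ×ˢ (Set.univ : Set ℝ) := ⟨hΩ0, trivial⟩
  have hSe := hS.dirDeriv_of_isOpen hO (0, 1)
  let j : W →L[ℝ] (U × V × W) × ℝ := (ContinuousLinearMap.inl ℝ (U × V × W) ℝ).comp
    ((ContinuousLinearMap.inr ℝ U (V × W)).comp (ContinuousLinearMap.inr ℝ V W))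
  have hslice (f : (U × V × W) × ℝ → ℝ) (hf : ContDiffOn ℝ (⊤ : ℕ∞) f (Ω ×ˢ Set.univ)) :
      HasFDerivAt (fun τ : W => f ((0, 0, τ), 0)) ((fderiv ℝ f 0).comp j) 0 :=
    HasFDerivAt.comp (f := j) 0 (by
      rw [map_zero]; exact (hf.hasStrictFDerivAt_of_isOpen hO h0).hasFDerivAt) j.hasFDerivAt
  let b := stdOrthonormalBasis ℝ U
  let D : U → W →L[ℝ] ℝ := fun a =>
    (fderiv ℝ (dirDeriv ((a, 0, 0), 0) (dirDeriv (0, 1) S)) 0).comp j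
  have hga (a : U) : HasFDerivAt (fun τ => ⟪g τ, a⟫) (D a) 0 :=
    (hslice _ (hSe.dirDeriv_of_isOpen hO ((a, 0, 0), 0))).congr_of_eventuallyEq
      (by filter_upwards [hg] with τ hτ using hτ a)
  have hgd : DifferentiableAt ℝ g 0 := by
    have : g = fun τ => ∑ i, ⟪g τ, b i⟫ • b i := by
      funext τ
      simpa only [real_inner_comm] using (b.sum_repr' (g τ)).symm
    rw [this]
    exact DifferentiableAt.fun_sum fun i _ => (hga (b i)).differentiableAt.smul_const _
  have hgD (a : U) : ⟪fderiv ℝ g 0 t, a⟫ = D a t := by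
    have h1 := hgd.hasFDerivAt.inner ℝ (hasFDerivAt_const a (0 : W))
    rw [(hga a).unique h1]
    simp [fderivInnerCLM_apply]
  let M : U →L[ℝ] U := L₀.symm.toLinearMap.toContinuousLinearMap
  have hM (x y : U) : ⟪M x, y⟫ = ⟪x, M y⟫ := by
    change ⟪L₀.symm x, y⟫ = ⟪x, L₀.symm y⟫
    have := hL₀ (L₀.symm x) (L₀.symm y)
    simpa using this.symm
  have hgM := (M.hasFDerivAt.comp (0 : W) hgd.hasFDerivAt).neg
  have hder := ((hgd.hasFDerivAt.inner ℝ hgM).const_mul (1 / 2)).add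
    ((hslice _ (hSe.dirDeriv_of_isOpen hO (0, 1))).const_mul (1 / 2))
  have hder' : HasFDerivAt S₀' _ 0 := hder.congr_of_eventuallyEq (by
    filter_upwards [hS₀'] with τ hτ using hτ)
  have e1 : D (-(M (g 0))) t = dirDeriv ((-(L₀.symm (g 0)), 0, 0), 0)
      (dirDeriv (0, 1) (dirDeriv ((0, 0, t), 0) S)) 0 :=
    (dirDeriv_comm hSe hO ((0, 0, t), 0) _ h0).trans
      (dirDeriv_congr hO (dirDeriv_comm hS hO _ _) _ h0)
  have e2 : ((fderiv ℝ (dirDeriv (0, 1) (dirDeriv (0, 1) S)) 0).comp j) t =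
      dirDeriv (0, 1) (dirDeriv (0, 1) (dirDeriv ((0, 0, t), 0) S)) 0 :=
    (dirDeriv_comm hSe hO ((0, 0, t), 0) _ h0).trans
      (dirDeriv_congr hO (dirDeriv_comm hS hO _ _) _ h0)
  rw [hder'.fderiv, ← e1, ← e2, ← hgD]
  have h5 : ⟪g 0, M (fderiv ℝ g 0 t)⟫ = ⟪fderiv ℝ g 0 t, M (g 0)⟫ := by
    rw [← hM, real_inner_comm]
  simp [fderivInnerCLM_apply, h5]
  ring

end NormalForm

/-- If `0` is not a critical point of the leading term `S'₀`, then for all small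
`ε ≠ 0` the perturbed function `S(·,ε)` has no critical points near the origin. -/
theorem stmt5
    {U V W : Type*} [NormedAddCommGroup U] [InnerProductSpace ℝ U] [FiniteDimensional ℝ U]
    [NormedAddCommGroup V] [InnerProductSpace ℝ V] [FiniteDimensional ℝ V]
    [NormedAddCommGroup W] [InnerProductSpace ℝ W] [FiniteDimensional ℝ W]
    (Ω : Set (U × V × W)) (hΩ : IsOpen Ω) (hΩ0 : (0 : U × V × W) ∈ Ω)
    (S : (U × V × W) × ℝ → ℝ) (hS : ContDiffOn ℝ (⊤ : ℕ∞) S (Ω ×ˢ Set.univ))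
    (S₁ S₂ : U × V × W → ℝ)
    (hS₁def : ∀ p, S₁ p = deriv (fun e => S (p, e)) 0)
    (hS₂def : ∀ p, S₂ p = (1 / 2) * deriv (fun e => deriv (fun e' => S (p, e')) e) 0)
    (L₀ : U ≃ₗ[ℝ] U) (hL₀ : ∀ x y : U, ⟪L₀ x, y⟫ = ⟪x, L₀ y⟫) (c₀ : ℝ)
    (hNF0 : ∀ p ∈ Ω, S (p, 0) = (1 / 2) * ⟪L₀ p.1, p.1⟫ + c₀)
    (L₁ : V ≃ₗ[ℝ] V) (hL₁ : ∀ x y : V, ⟪L₁ x, y⟫ = ⟪x, L₁ y⟫) (c₁ : ℝ)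
    (hNF1 : ∀ (v : V) (w : W), ((0, v, w) : U × V × W) ∈ Ω →
      S₁ (0, v, w) = (1 / 2) * ⟪L₁ v, v⟫ + c₁)
    (g lam : W → U)
    (hg : ∀ t, g t = gradient (fun u' : U => S₁ (u', 0, t)) 0)
    (hlam : ∀ t, lam t = -(L₀.symm (g t)))
    (S₀' : W → ℝ)
    (hS₀'def : ∀ t, S₀' t = (1 / 2) * ⟪g t, lam t⟫ + S₂ (0, 0, t))
    (hnotcrit : fderiv ℝ S₀' 0 ≠ 0) :
    ∃ (U₀ : Set (U × V × W)) (ε₀ : ℝ),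
      IsOpen U₀ ∧ (0 : U × V × W) ∈ U₀ ∧ U₀ ⊆ Ω ∧ 0 < ε₀ ∧
      ∀ ε : ℝ, 0 < |ε| → |ε| < ε₀ →
        ∀ y ∈ U₀, fderiv ℝ (fun p => S (p, ε)) y ≠ 0 := by
  have hO : IsOpen (Ω ×ˢ (Set.univ : Set ℝ)) := hΩ.prod isOpen_univ
  have hdiff {f : (U × V × W) × ℝ → ℝ} (hf : ContDiffOn ℝ (⊤ : ℕ∞) f (Ω ×ˢ Set.univ))
      {p : U × V × W} (hp : p ∈ Ω) (e : ℝ) : DifferentiableAt ℝ f (p, e) :=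
    (hf.hasStrictFDerivAt_of_isOpen hO ⟨hp, trivial⟩).differentiableAt
  have hSe := hS.dirDeriv_of_isOpen hO (0, 1)
  have hS₁ (p) (hp : p ∈ Ω) : S₁ p = dirDeriv (0, 1) S (p, 0) := by
    rw [hS₁def, deriv_param_eq_dirDeriv (hdiff hS hp 0)]
  have hS₂ (p) (hp : p ∈ Ω) :
      S₂ p = (1 / 2) * dirDeriv (0, 1) (dirDeriv (0, 1) S) (p, 0) := by
    rw [hS₂def, ← deriv_param_eq_dirDeriv (hdiff hSe hp 0)]
    simp_rw [fun e => deriv_param_eq_dirDeriv (hdiff hS hp e)]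
  have hS₁deriv (p) (hp : p ∈ Ω) :
      HasFDerivAt S₁ ((fderiv ℝ (dirDeriv (0, 1) S) (p, 0)).comp
        (ContinuousLinearMap.inl ℝ (U × V × W) ℝ)) p := by
    have h1 : HasFDerivAt (fun q : U × V × W => dirDeriv (0, 1) S (q, 0))
        ((fderiv ℝ (dirDeriv (0, 1) S) (p, 0)).comp (ContinuousLinearMap.inl ℝ _ ℝ)) p :=
      HasFDerivAt.comp (f := fun q : U × V × W => (q, (0 : ℝ))) p (hdiff hSe hp 0).hasFDerivAt
        (hasFDerivAt_prodMk_left p 0)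
    refine h1.congr_of_eventuallyEq ?_
    filter_upwards [hΩ.mem_nhds hp] with q hq using hS₁ q hq
  have hgrad (τ : W) (hτ : ((0, 0, τ) : U × V × W) ∈ Ω) (a : U) :
      ⟪g τ, a⟫ = dirDeriv ((a, 0, 0), 0) (dirDeriv (0, 1) S) ((0, 0, τ), 0) := by
    have h1 : HasFDerivAt (fun u' : U => S₁ (u', 0, τ)) _ 0 :=
      HasFDerivAt.comp (f := fun u' : U => ((u', 0, τ) : U × V × W)) 0 (hS₁deriv _ hτ)
        (hasFDerivAt_prodMk_left 0 (0, τ))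
    rw [hg, gradient, InnerProductSpace.toDual_symm_apply, h1.fderiv]
    rfl
  have hW : ∀ᶠ τ in 𝓝 (0 : W), ((0, 0, τ) : U × V × W) ∈ Ω := by
    have hc : Continuous (fun τ : W => ((0, 0, τ) : U × V × W)) := by fun_prop
    exact (hc.tendsto' 0 0 rfl) (hΩ.mem_nhds hΩ0)
  have hlead := fderiv_leading_term hΩ hΩ0 hS L₀ hL₀ g
    (by filter_upwards [hW] with τ hτ using hgrad τ hτ) S₀'
    (by filter_upwards [hW] with τ hτ; rw [hS₀'def, hlam, hS₂ _ hτ])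
  obtain ⟨t, ht⟩ : ∃ t, fderiv ℝ S₀' 0 t ≠ 0 := by
    by_contra! h
    exact hnotcrit (ContinuousLinearMap.ext h)
  rw [hlead] at ht
  have hS0t (p) (hp : p ∈ Ω) : dirDeriv ((0, 0, t), 0) S (p, 0) = 0 := by
    rw [dirDeriv_of_quadratic hΩ hS L₀ hL₀ c₀ hNF0 hp, inner_zero_right]
  have hS1t (v w) (hp : ((0, v, w) : U × V × W) ∈ Ω) :
      dirDeriv (0, 1) (dirDeriv ((0, 0, t), 0) S) ((0, v, w), 0) = 0 := by
    rw [dirDeriv_comm hS hO (0, 1) _ ⟨hp, trivial⟩]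
    have h1 : HasFDerivAt (fun w' : W => S₁ (0, v, w')) _ w :=
      HasFDerivAt.comp (f := fun w' : W => ((0, v, w') : U × V × W)) w (hS₁deriv _ hp)
        ((hasFDerivAt_const _ _).prodMk (hasFDerivAt_prodMk_right v w))
    have hc : Continuous (fun w' : W => ((0, v, w') : U × V × W)) := by fun_prop
    have h2 : HasFDerivAt (fun w' : W => S₁ (0, v, w')) (0 : W →L[ℝ] ℝ) w :=
      (hasFDerivAt_const ((1 / 2) * ⟪L₁ v, v⟫ + c₁) w).congr_of_eventuallyEq (by
        filter_upwards [hc.continuousAt (hΩ.mem_nhds hp)] with w' hw' using hNF1 v w' hw')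
    simpa [dirDeriv] using congrArg (fun A : W →L[ℝ] ℝ => A t) (h1.unique h2)
  have hev : ∀ᶠ x in 𝓝 (0 : (U × V × W) × ℝ),
      x.2 ≠ 0 → ¬ ∀ a : U × V × W, dirDeriv (a, 0) S x = 0 := by
    by_contra hcon
    let P : Set ((U × V × W) × ℝ) := {x | x.2 ≠ 0 ∧ ∀ a : U × V × W, dirDeriv (a, 0) S x = 0}
    have hfreq : ∃ᶠ x in 𝓝 (0 : (U × V × W) × ℝ), x ∈ P := by
      refine fun h => hcon (h.mono fun x hx h1 h2 => hx ⟨h1, h2⟩)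
    have : (𝓝 (0 : (U × V × W) × ℝ) ⊓ 𝓟 P).NeBot := frequently_mem_iff_neBot.1 hfreq
    have hP : ∀ᶠ x in 𝓝 (0 : (U × V × W) × ℝ) ⊓ 𝓟 P, x ∈ P :=
      mem_inf_of_right (mem_principal_self P)
    have hne := hP.mono fun x hx => hx.1
    have hcr := hP.mono fun x hx => hx.2
    exact ht (leading_term_eq_zero_of_critical hΩ hΩ0 hS t hS0t hS1t _ inf_le_left hne hcr
      (tendsto_inv_smul_of_critical hΩ hΩ0 hS L₀ hL₀ c₀ hNF0 (g 0) (hgrad 0 hΩ0)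
        inf_le_left hne hcr))
  obtain ⟨r, hr, hball⟩ := Metric.eventually_nhds_iff_ball.1 hev
  refine ⟨Ω ∩ Metric.ball 0 r, r, hΩ.inter Metric.isOpen_ball, ⟨hΩ0, Metric.mem_ball_self hr⟩,
    Set.inter_subset_left, hr, fun ε hε hεr y hy hfd => ?_⟩
  refine hball (y, ε) ?_ (abs_pos.1 hε) fun a => ?_
  · have := hy.2
    simp only [Metric.mem_ball, dist_zero_right, Prod.norm_def (_, _), sup_lt_iff,
      Real.norm_eq_abs] at this ⊢
    exact ⟨by simpa using this, hεr⟩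
  · rw [← fderiv_slice_apply (hdiff hS hy.1 ε), hfd]
    rfl
end

section
/- Let U and M be finite-dimensional real inner product spaces, Ω ⊆ U × M an open neighborhood of the origin, and S : Ω × ℝ → ℝ a smooth function such that S(u,m,0) = (1/2)⟨L₀ u, u⟩ + c₀ for all (u,m) ∈ Ω, where L₀ : U → U is a self-adjoint linear isomorphism and c₀ ∈ ℝ. Let δ > 0 and let x : (−δ,δ) → Ω, ẋ : (−δ,δ) → U × M, μ : (−δ,δ) → ℝ be smooth maps such that: x(0) = 0; for every ε ∈ (−δ,δ), x(ε) is a critical point of S(·,ε); ẋ(ε) ≠ 0 for every ε; and for every ε and every y ∈ U × M one has D²(S(·,ε))(x(ε))(ẋ(ε), y) = μ(ε)·⟨ẋ(ε), y⟩ (so ẋ(ε) is an eigenvector of the Hessian of S(·,ε) at x(ε) with eigenvalue μ(ε)). If μ(0) = 0, then the U-component of ẋ(0) vanishes, and, writing ẋ(0) = (0, ṁ₀), for every n ∈ M one has D²(m ↦ S₁(0,m))(0)(ṁ₀, n) = μ'(0)·⟨ṁ₀, n⟩; that is, ṁ₀ is an eigenvector with eigenvalue μ'(0) of the Hessian at 0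 of the restriction of S₁ to {0} × M, where S₁ := (∂S/∂ε)(·,0). -/
open scoped RealInnerProductSpace Topology

section SecondDerivatives

variable {E F : Type*} [NormedAddCommGroup E] [NormedSpace ℝ E]
  [NormedAddCommGroup F] [NormedSpace ℝ F]

/-- The second derivative of a function composed with an affine map. -/
theorem fderiv_fderiv_comp_affine (f : F → ℝ) (ι : E →L[ℝ] F) (c : F) (p v w : E)
    (hf : ContDiffAt ℝ 2 f (ι p + c)) :
    fderiv ℝ (fderiv ℝ (fun q => f (ι q + c))) p v w
      = fderiv ℝ (fderiv ℝ f) (ι p + c) (ι v) (ι w) := by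
  have hA : ∀ q, HasFDerivAt (fun q => ι q + c) ι q := fun q => ι.hasFDerivAt.add_const c
  have hev : ∀ᶠ q in 𝓝 p, DifferentiableAt ℝ f (ι q + c) :=
    (hA p).continuousAt.eventually
      ((hf.eventually (by simp)).mono fun z hz => hz.differentiableAt (by norm_num))
  have hfd : fderiv ℝ (fun q => f (ι q + c)) =ᶠ[𝓝 p]
      fun q => (fderiv ℝ f (ι q + c)).comp ι := by
    filter_upwards [hev] with q hq
    exact (hq.hasFDerivAt.comp q (hA q)).fderiv
  have h2 : HasFDerivAt (fderiv ℝ f) (fderiv ℝ (fderiv ℝ f) (ι p + c)) (ι p + c) :=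
    ((hf.fderiv_right (m := 1) (by norm_num)).differentiableAt (by norm_num)).hasFDerivAt
  have h3 : HasFDerivAt (fun q => fderiv ℝ f (ι q + c))
      ((fderiv ℝ (fderiv ℝ f) (ι p + c)).comp ι) p := h2.comp p (hA p)
  rw [hfd.fderiv_eq, (h3.clm_comp (hasFDerivAt_const ι p)).fderiv]
  simp

/-- Differentiating a directional derivative. -/
theorem fderiv_fderiv_apply {f : F → ℝ} {z : F} (hf : ContDiffAt ℝ 2 f z) (v w : F) :
    fderiv ℝ (fun z => fderiv ℝ f z w) z v = fderiv ℝ (fderiv ℝ f) z v w := by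
  have h2 : DifferentiableAt ℝ (fderiv ℝ f) z :=
    (hf.fderiv_right (m := 1) (by norm_num)).differentiableAt (by norm_num)
  rw [(h2.hasFDerivAt.clm_apply (hasFDerivAt_const w z)).fderiv]
  simp

/-- Directional derivatives of a smooth function are smooth. -/
theorem ContDiffAt.fderiv_apply_const {f : F → ℝ} {z : F}
    (hf : ContDiffAt ℝ (⊤ : ℕ∞) f z) (w : F) :
    ContDiffAt ℝ (⊤ : ℕ∞) (fun z => fderiv ℝ f z w) z :=
  (hf.fderiv_right (m := (⊤ : ℕ∞)) (by simp)).clm_apply contDiffAt_const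

theorem fderiv_fderiv_comm {f : F → ℝ} {z : F} (hf : ContDiffAt ℝ 2 f z) (v w : F) :
    fderiv ℝ (fderiv ℝ f) z v w = fderiv ℝ (fderiv ℝ f) z w v :=
  hf.isSymmSndFDerivAt (by simp) v w

/-- Third derivatives commute: the directional derivative moved from the outside to the inside. -/
theorem fderiv_fderiv_fderiv_apply_comm {f : F → ℝ} {z : F}
    (hf : ContDiffAt ℝ (⊤ : ℕ∞) f z) (t v w : F) :
    fderiv ℝ (fderiv ℝ (fun z => fderiv ℝ f z w)) z t v
      = fderiv ℝ (fderiv ℝ (fun z => fderiv ℝ f z t)) z v w := by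
  have two_le : (2 : WithTop ℕ∞) ≤ ((⊤ : ℕ∞) : WithTop ℕ∞) :=
    WithTop.coe_le_coe.2 (le_top : (2 : ℕ∞) ≤ ⊤)
  have hw := (hf.fderiv_apply_const w).of_le two_le
  have ht := (hf.fderiv_apply_const t).of_le two_le
  have hev : (fun z => fderiv ℝ (fun z => fderiv ℝ f z w) z t) =ᶠ[𝓝 z]
      fun z => fderiv ℝ (fun z => fderiv ℝ f z t) z w := by
    filter_upwards [(hf.of_le two_le).eventually (by simp)] with q hq
    rw [fderiv_fderiv_apply hq, fderiv_fderiv_apply hq, fderiv_fderiv_comm hq]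
  rw [fderiv_fderiv_comm hw, ← fderiv_fderiv_apply hw, hev.fderiv_eq, fderiv_fderiv_apply ht]

/-- The derivative of a directional derivative along a path, with varying direction. -/
theorem hasDerivAt_fderiv_apply_path {f : F → ℝ} {z w : ℝ → F} {z' w' : F} {t : ℝ}
    (hf : ContDiffAt ℝ 2 f (z t)) (hz : HasDerivAt z z' t) (hw : HasDerivAt w w' t) :
    HasDerivAt (fun t => fderiv ℝ f (z t) (w t))
      (fderiv ℝ (fderiv ℝ f) (z t) z' (w t) + fderiv ℝ f (z t) w') t := by
  have h2 : HasFDerivAt (fderiv ℝ f) (fderiv ℝ (fderiv ℝ f) (z t)) (z t) :=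
    ((hf.fderiv_right (m := 1) (by norm_num)).differentiableAt (by norm_num)).hasFDerivAt
  have h3 : HasDerivAt (fun t => fderiv ℝ f (z t)) (fderiv ℝ (fderiv ℝ f) (z t) z') t :=
    h2.comp_hasDerivAt t hz
  exact h3.clm_apply hw

/-- The derivative in the first variable, as a joint derivative. -/
theorem fderiv_prodMk_left_apply {f : E × F → ℝ} {p : E} {e : F}
    (hf : DifferentiableAt ℝ f (p, e)) (v : E) :
    fderiv ℝ (fun p => f (p, e)) p v = fderiv ℝ f (p, e) (v, 0) := by
  have h : HasFDerivAt (fun p => f (p, e))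
      ((fderiv ℝ f (p, e)).comp (ContinuousLinearMap.inl ℝ E F)) p :=
    HasFDerivAt.comp (g := f) (f := fun q : E => (q, e)) p hf.hasFDerivAt
      (hasFDerivAt_prodMk_left p e)
  rw [h.fderiv]
  simp

/-- The second derivative in the first variable, as a joint second derivative. -/
theorem fderiv_fderiv_prodMk_left_apply {f : E × F → ℝ} {p : E} {e : F}
    (hf : ContDiffAt ℝ 2 f (p, e)) (v w : E) :
    fderiv ℝ (fderiv ℝ (fun p => f (p, e))) p v w
      = fderiv ℝ (fderiv ℝ f) (p, e) (v, 0) (w, 0) := by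
  have := fderiv_fderiv_comp_affine f (ContinuousLinearMap.inl ℝ E F) (0, e) p v w
    (by simpa using hf)
  simpa using this

/-- The derivative of the quadratic form of a symmetric operator. -/
theorem fderiv_half_inner_apply {U : Type*} [NormedAddCommGroup U] [InnerProductSpace ℝ U]
    (L : U →L[ℝ] U) (hL : ∀ x y : U, ⟪L x, y⟫ = ⟪x, L y⟫) (ι : E →L[ℝ] U) (c : ℝ) (p w : E) :
    fderiv ℝ (fun p => (1 / 2) * ⟪L (ι p), ι p⟫ + c) p w = ⟪L (ι w), ι p⟫ := by
  have hLι : HasFDerivAt (fun p => L (ι p)) (L.comp ι) p := (L.comp ι).hasFDerivAt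
  rw [(((hLι.inner ℝ ι.hasFDerivAt).const_mul (1 / 2 : ℝ)).add_const c).fderiv]
  simp only [smul_apply, ContinuousLinearMap.comp_apply, ContinuousLinearMap.prod_apply,
    fderivInnerCLM_apply, smul_eq_mul]
  rw [hL (ι p) (ι w), real_inner_comm (L (ι w)) (ι p)]
  ring

end SecondDerivatives

/-- Behaviour of eigenvalue/eigenvector paths of the Hessians along a path of
critical points of the perturbation: if the eigenvalue vanishes at `ε = 0`, the eigenvector lies
in the kernel direction and is an eigenvector of the Hessian of `S₁` restricted to `{0} × M`,
with eigenvalue `μ'(0)`.  The inner product on `U × M` is the product inner product,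
written out in components. -/
theorem stmt6
    {U M : Type*} [NormedAddCommGroup U] [InnerProductSpace ℝ U] [FiniteDimensional ℝ U]
    [NormedAddCommGroup M] [InnerProductSpace ℝ M] [FiniteDimensional ℝ M]
    (Ω : Set (U × M)) (hΩ : IsOpen Ω) (hΩ0 : (0 : U × M) ∈ Ω)
    (S : (U × M) × ℝ → ℝ) (hS : ContDiffOn ℝ (⊤ : ℕ∞) S (Ω ×ˢ Set.univ))
    (S₁ : U × M → ℝ) (hS₁def : ∀ p, S₁ p = deriv (fun e => S (p, e)) 0)
    (L₀ : U ≃ₗ[ℝ] U) (hL₀ : ∀ x y : U, ⟪L₀ x, y⟫ = ⟪x, L₀ y⟫) (c₀ : ℝ)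
    (hNF0 : ∀ p ∈ Ω, S (p, 0) = (1 / 2) * ⟪L₀ p.1, p.1⟫ + c₀)
    (δ : ℝ) (hδ : 0 < δ)
    (x xdot : ℝ → U × M) (μ : ℝ → ℝ)
    (hxsmooth : ContDiffOn ℝ (⊤ : ℕ∞) x (Set.Ioo (-δ) δ))
    (hxdotsmooth : ContDiffOn ℝ (⊤ : ℕ∞) xdot (Set.Ioo (-δ) δ))
    (hμsmooth : ContDiffOn ℝ (⊤ : ℕ∞) μ (Set.Ioo (-δ) δ))
    (hxΩ : ∀ ε ∈ Set.Ioo (-δ) δ, x ε ∈ Ω)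
    (hx0 : x 0 = 0)
    (hcrit : ∀ ε ∈ Set.Ioo (-δ) δ, fderiv ℝ (fun p => S (p, ε)) (x ε) = 0)
    (hxdot_ne : ∀ ε ∈ Set.Ioo (-δ) δ, xdot ε ≠ 0)
    (heig : ∀ ε ∈ Set.Ioo (-δ) δ, ∀ y : U × M,
      fderiv ℝ (fderiv ℝ (fun p => S (p, ε))) (x ε) (xdot ε) y
        = μ ε * (⟪(xdot ε).1, y.1⟫ + ⟪(xdot ε).2, y.2⟫))
    (hμ0 : μ 0 = 0) :
    (xdot 0).1 = 0 ∧
      ∀ n : M,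
        fderiv ℝ (fderiv ℝ (fun m : M => S₁ (0, m))) 0 (xdot 0).2 n
          = deriv μ 0 * ⟪(xdot 0).2, n⟫ := by
  have two_le : (2 : WithTop ℕ∞) ≤ ((⊤ : ℕ∞) : WithTop ℕ∞) :=
    WithTop.coe_le_coe.2 (le_top : (2 : ℕ∞) ≤ ⊤)
  have hSat : ∀ p ∈ Ω, ∀ e : ℝ, ContDiffAt ℝ (⊤ : ℕ∞) S (p, e) := fun p hp e =>
    hS.contDiffAt ((hΩ.prod isOpen_univ).mem_nhds ⟨hp, Set.mem_univ e⟩)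
  have hI0 : Set.Ioo (-δ) δ ∈ 𝓝 (0 : ℝ) := Ioo_mem_nhds (by linarith) hδ
  have h0I : (0 : ℝ) ∈ Set.Ioo (-δ) δ := mem_of_mem_nhds hI0
  -- The unperturbed gradient and Hessian.
  let L : U →L[ℝ] U := LinearMap.toContinuousLinearMap (L₀ : U →ₗ[ℝ] U)
  have hgrad : ∀ p ∈ Ω, ∀ w : U × M, fderiv ℝ (fun p => S (p, 0)) p w = ⟪L₀ w.1, p.1⟫ := by
    intro p hp w
    have hev : (fun p => S (p, 0)) =ᶠ[𝓝 p]
        fun p : U × M => (1 / 2) * ⟪L p.1, p.1⟫ + c₀ := by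
      filter_upwards [hΩ.mem_nhds hp] with q hq using hNF0 q hq
    rw [hev.fderiv_eq]
    exact fderiv_half_inner_apply L hL₀ (ContinuousLinearMap.fst ℝ U M) c₀ p w
  have hgradΩ : ∀ p ∈ Ω, ∀ w : U × M, fderiv ℝ S (p, 0) (w, 0) = ⟪L₀ w.1, p.1⟫ := by
    intro p hp w
    rw [← fderiv_prodMk_left_apply ((hSat p hp 0).differentiableAt (by simp)), hgrad p hp]
  have hS0 := hSat 0 hΩ0 0
  have hHess : ∀ v w : U × M,
      fderiv ℝ (fderiv ℝ (fun p => S (p, 0))) 0 v w = ⟪L₀ w.1, v.1⟫ := by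
    intro v w
    have hΦ := hS0.fderiv_apply_const (w, 0)
    rw [fderiv_fderiv_prodMk_left_apply (hS0.of_le two_le),
      ← fderiv_fderiv_apply (hS0.of_le two_le),
      ← fderiv_prodMk_left_apply (hΦ.differentiableAt (by simp))]
    have hev : (fun p => fderiv ℝ S (p, 0) (w, 0)) =ᶠ[𝓝 (0 : U × M)]
        fun p => (innerSL ℝ (L₀ w.1)).comp (ContinuousLinearMap.fst ℝ U M) p := by
      filter_upwards [hΩ.mem_nhds hΩ0] with q hq
      simpa using hgradΩ q hq w
    rw [hev.fderiv_eq, ContinuousLinearMap.fderiv]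
    simp
  have hU : (xdot 0).1 = 0 := by
    have h := heig 0 h0I (L₀.symm (xdot 0).1, 0)
    rw [hx0, hHess, hμ0] at h
    simpa using h
  refine ⟨hU, fun n => ?_⟩
  set y : U × M := (0, n) with hy
  set Φ : (U × M) × ℝ → ℝ := fun z => fderiv ℝ S z (y, 0) with hΦdef
  set Ψ : (U × M) × ℝ → ℝ := fun z => fderiv ℝ S z (0, 1) with hΨdef
  have hΦ : ContDiffAt ℝ (⊤ : ℕ∞) Φ (0, 0) := hS0.fderiv_apply_const _
  have hΨ : ContDiffAt ℝ (⊤ : ℕ∞) Ψ (0, 0) := hS0.fderiv_apply_const _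
  have hΦzero : (fun p => Φ (p, 0)) =ᶠ[𝓝 (0 : U × M)] fun _ => 0 := by
    filter_upwards [hΩ.mem_nhds hΩ0] with q hq
    simpa [hy] using hgradΩ q hq y
  have hDΦ : ∀ v : U × M, fderiv ℝ Φ (0, 0) (v, 0) = 0 := by
    intro v
    rw [← fderiv_prodMk_left_apply (hΦ.differentiableAt (by simp)), hΦzero.fderiv_eq]
    simp
  have hDDΦ : ∀ v w : U × M, fderiv ℝ (fderiv ℝ Φ) (0, 0) (v, 0) (w, 0) = 0 := by
    intro v w
    rw [← fderiv_fderiv_prodMk_left_apply (hΦ.of_le two_le), hΦzero.fderiv.fderiv_eq]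
    simp
  -- The eigenvalue equation, differentiated at the origin of the path.
  have hpath : (fun ε => fderiv ℝ Φ (x ε, ε) (xdot ε, 0)) =ᶠ[𝓝 0]
      fun ε => μ ε * ⟪(xdot ε).2, n⟫ := by
    filter_upwards [hI0] with ε hε
    have hSε := (hSat (x ε) (hxΩ ε hε) ε).of_le two_le
    rw [hΦdef, fderiv_fderiv_apply hSε, ← fderiv_fderiv_prodMk_left_apply hSε, heig ε hε]
    simp [hy]
  have hx' := ((hxsmooth.contDiffAt hI0).differentiableAt (by simp)).hasDerivAt
  have hxdot' := ((hxdotsmooth.contDiffAt hI0).differentiableAt (by simp)).hasDerivAt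
  have hμ' := ((hμsmooth.contDiffAt hI0).differentiableAt (by simp)).hasDerivAt
  have hz : HasDerivAt (fun ε => (x ε, ε)) (deriv x 0, (1 : ℝ)) 0 :=
    hx'.prodMk (hasDerivAt_id (0 : ℝ))
  have hw : HasDerivAt (fun ε => (xdot ε, (0 : ℝ))) (deriv xdot 0, (0 : ℝ)) 0 :=
    hxdot'.prodMk (hasDerivAt_const (0 : ℝ) (0 : ℝ))
  have hleft : HasDerivAt (fun ε => fderiv ℝ Φ (x ε, ε) (xdot ε, 0))
      (fderiv ℝ (fderiv ℝ Φ) (x 0, 0) (deriv x 0, 1) (xdot 0, 0)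
        + fderiv ℝ Φ (x 0, 0) (deriv xdot 0, 0)) 0 :=
    hasDerivAt_fderiv_apply_path (f := Φ) (z := fun ε => (x ε, ε))
      (by simpa only [hx0] using hΦ.of_le two_le) hz hw
  have hsnd : HasDerivAt (fun ε => ⟪n, (xdot ε).2⟫) ⟪n, (deriv xdot 0).2⟫ 0 :=
    ((innerSL ℝ n).comp (ContinuousLinearMap.snd ℝ U M)).hasFDerivAt.comp_hasDerivAt
      (0 : ℝ) hxdot'
  have hright : HasDerivAt (fun ε => μ ε * ⟪(xdot ε).2, n⟫)
      (deriv μ 0 * ⟪(xdot 0).2, n⟫ + μ 0 * ⟪(deriv xdot 0).2, n⟫) 0 := by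
    simpa only [real_inner_comm n] using hμ'.fun_mul hsnd
  have heq := (hleft.congr_of_eventuallyEq hpath.symm).unique hright
  have hsplit : ((deriv x 0, 1) : (U × M) × ℝ) = (deriv x 0, 0) + (0, 1) := by simp
  simp only [hx0, hDΦ, hμ0, hsplit, map_add,
    add_apply, hDDΦ, zero_add, add_zero, zero_mul] at heq
  rw [fderiv_fderiv_fderiv_apply_comm hS0] at heq
  have hS₁ : (fun m : M => S₁ (0, m)) =ᶠ[𝓝 0] fun m => Ψ ((0, m), 0) := by
    have hc : ContinuousAt (fun m : M => ((0, m) : U × M)) 0 := by fun_prop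
    filter_upwards [hc.preimage_mem_nhds (hΩ.mem_nhds hΩ0)] with m hm
    have hd : HasFDerivAt S (fderiv ℝ S ((0, m), 0)) (((0, m), (0 : ℝ)) : (U × M) × ℝ) :=
      ((hSat _ hm 0).differentiableAt (by simp)).hasFDerivAt
    rw [hS₁def]
    exact (hd.comp_hasDerivAt (0 : ℝ)
      ((hasDerivAt_const (0 : ℝ) ((0, m) : U × M)).prodMk (hasDerivAt_id (0 : ℝ)))).deriv
  have hrestr := fderiv_fderiv_comp_affine Ψ
    ((ContinuousLinearMap.inl ℝ (U × M) ℝ).comp (ContinuousLinearMap.inr ℝ U M)) 0 0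
    (xdot 0).2 n (by rw [map_zero, add_zero]; exact hΨ.of_le two_le)
  have hxd : xdot 0 = (0, (xdot 0).2) := Prod.ext hU rfl
  rw [hS₁.fderiv.fderiv_eq]
  simp only [ContinuousLinearMap.comp_apply, ContinuousLinearMap.inl_apply,
    ContinuousLinearMap.inr_apply, add_zero, map_zero] at hrestr
  rw [hrestr, ← hxd, ← heq]
  rfl
end

section
/- Let E be a finite-dimensional real normed space, S : E × ℝ → ℝ a smooth function, and ψ : E → ℝ a proper continuous function with ψ ≥ 0. Write S₀ := S(·,0) and S₁ := (∂S/∂ε)(·,0). Assume S₀ is Morse–Bott in the following sense: for every critical point x of S₀ there exist finite-dimensional real inner product spaces U and H, an open neighborhood Ω_x of x in E, an open set Ω' ⊆ U × H, a bijective smooth map φ : Ω_x → Ω' with smooth inverse, a self-adjoint linear isomorphism L_x : U → U and a constant c_x ∈ ℝ such that S₀(φ^{-1}(u,h)) = (1/2)⟨L_x u, u⟩ + c_x for all (u,h) ∈ Ω'. Define Z₁ := { x ∈ E : DS₀(x) = 0 and DS₁(x)(v) = 0 for every v ∈ E with D²S₀(x)(v,·) = 0 }, and assume Z₁ is compact.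 Then for every constant C > 0 and every open set 𝒰 ⊆ E with Z₁ ⊆ 𝒰 ⊆ {x : ψ(x) < C}, there exists ε₀ > 0 such that for all ε with 0 < |ε| ≤ ε₀, every critical point x of S(·,ε) satisfies either x ∈ 𝒰 or ψ(x) > C. -/
open scoped RealInnerProductSpace

open Filter Topology

/-- In a Morse–Bott chart around a critical point `x`, every vector of the kernel of the Hessian
extends to a vector field, continuous at `x`, along which the function is constant. -/
lemma exists_field_of_mem_ker_hessian
    {E U H : Type*} [NormedAddCommGroup E] [NormedSpace ℝ E]
    [NormedAddCommGroup U] [InnerProductSpace ℝ U] [FiniteDimensional ℝ U]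
    [NormedAddCommGroup H] [NormedSpace ℝ H]
    {f : E → ℝ} (hf : ContDiff ℝ 2 f) {x : E} (hx : fderiv ℝ f x = 0)
    {Ωx : Set E} {Ω' : Set (U × H)} {φ : E → U × H} {φinv : U × H → E}
    {L : U ≃ₗ[ℝ] U} {c : ℝ} (hΩ : IsOpen Ωx) (hxΩ : x ∈ Ωx) (hΩ' : IsOpen Ω')
    (hφ : ContDiffOn ℝ 1 φ Ωx) (hφm : Set.MapsTo φ Ωx Ω')
    (hφinv : ContDiffOn ℝ 2 φinv Ω')
    (hleft : ∀ y ∈ Ωx, φinv (φ y) = y)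
    (hL : ∀ a b, ⟪L a, b⟫ = ⟪a, L b⟫)
    (hquad : ∀ p ∈ Ω', f (φinv p) = (1 / 2) * ⟪L p.1, p.1⟫ + c)
    {v : E} (hv : fderiv ℝ (fderiv ℝ f) x v = 0) :
    ∃ V : E → E, ContinuousAt V x ∧ V x = v ∧ ∀ᶠ y in 𝓝 x, fderiv ℝ f y (V y) = 0 := by
  let T : U →L[ℝ] U := L.toLinearMap.toContinuousLinearMap
  have hT (u) : T u = L u := rfl
  have hφx : DifferentiableAt ℝ φ x :=
    (hφ.contDiffAt (hΩ.mem_nhds hxΩ)).differentiableAt (by simp)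
  have hinv (p) (hp : p ∈ Ω') : DifferentiableAt ℝ φinv p :=
    (hφinv.contDiffAt (hΩ'.mem_nhds hp)).differentiableAt (by simp)
  have key (w : U × H) (y) (hy : y ∈ Ωx) :
      fderiv ℝ f y (fderiv ℝ φinv (φ y) w) = ⟪T (φ y).1, w.1⟫ := by
    have hp := hφm hy
    have h1 : HasFDerivAt (fun p => f (φinv p))
        ((fderiv ℝ f y).comp (fderiv ℝ φinv (φ y))) (φ y) := by
      refine HasFDerivAt.comp (φ y) ?_ (hinv _ hp).hasFDerivAt
      rw [hleft y hy]
      exact (hf.differentiable (by simp) y).hasFDerivAt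
    have h2 : HasFDerivAt (fun p : U × H => (1 / 2) * ⟪T p.1, p.1⟫ + c) _ (φ y) :=
      (((T.hasFDerivAt.comp (φ y) hasFDerivAt_fst).inner ℝ
        (hasFDerivAt_fst (𝕜 := ℝ) (p := φ y))).const_mul (1 / 2)).add_const c
    have h3 := h1.unique (h2.congr_of_eventuallyEq
      ((hΩ'.eventually_mem hp).mono fun p hp => hquad p hp))
    have h4 := congrArg (fun A => A w) h3
    have h5 := hL w.1 (φ y).1
    rw [real_inner_comm (L (φ y).1)] at h5
    simp [hT] at h4 ⊢
    rw [h4, h5]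
    ring
  have hVdiff (w : U × H) :
      DifferentiableAt ℝ (fun y => fderiv ℝ φinv (φ y) w) x := by
    have h1 : DifferentiableAt ℝ (fderiv ℝ φinv) (φ x) :=
      ((hφinv.contDiffAt (hΩ'.mem_nhds (hφm hxΩ))).fderiv_right (m := 1)
        (by norm_num)).differentiableAt (by simp)
    exact (h1.comp x hφx).clm_apply (differentiableAt_const w)
  have hDD : DifferentiableAt ℝ (fderiv ℝ f) x :=
    (hf.fderiv_right (m := 1) (by norm_num)).differentiable (by simp) x
  have hker : (fderiv ℝ φ x v).1 = 0 := by
    set a := (fderiv ℝ φ x v).1 with ha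
    have h1 := hDD.hasFDerivAt.clm_apply (hVdiff (T a, 0)).hasFDerivAt
    have h2 : HasFDerivAt (fun y => ⟪T (φ y).1, T a⟫) _ x :=
      (T.hasFDerivAt.comp x hφx.hasFDerivAt.fst).inner ℝ (hasFDerivAt_const (T a) x)
    have h3 := h1.unique (h2.congr_of_eventuallyEq
      ((hΩ.eventually_mem hxΩ).mono fun y hy => key (T a, 0) y hy))
    have h4 := congrArg (fun A => A v) h3
    have h5 : T a = 0 := by
      have h6 : 0 = ‖T a‖ ^ 2 := by simpa [hx, hv, ← ha] using h4
      exact norm_eq_zero.1 (pow_eq_zero_iff two_ne_zero |>.1 h6.symm)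
    exact L.map_eq_zero_iff.1 h5
  refine ⟨fun y => fderiv ℝ φinv (φ y) (fderiv ℝ φ x v), (hVdiff _).continuousAt, ?_,
    (hΩ.eventually_mem hxΩ).mono fun y hy => ?_⟩
  · have h1 : HasFDerivAt (fun y => φinv (φ y)) _ x :=
      (hinv _ (hφm hxΩ)).hasFDerivAt.comp x hφx.hasFDerivAt
    have h2 := h1.unique ((hasFDerivAt_id x).congr_of_eventuallyEq
      ((hΩ.eventually_mem hxΩ).mono fun y hy => hleft y hy))
    exact congrArg (fun A => A v) h2
  · rw [key _ y hy, hker, inner_zero_right]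

lemma fderiv_slice_apply_s7 {E : Type*} [NormedAddCommGroup E] [NormedSpace ℝ E]
    {S : E × ℝ → ℝ} (hS : Differentiable ℝ S) (x : E) (ε : ℝ) (v : E) :
    fderiv ℝ (fun p => S (p, ε)) x v = fderiv ℝ S (x, ε) (v, 0) := by
  have h : HasFDerivAt (fun p => S (p, ε)) _ x :=
    (hS (x, ε)).hasFDerivAt.comp x (hasFDerivAt_prodMk_left x ε)
  rw [h.fderiv]
  simp

lemma deriv_slice {E : Type*} [NormedAddCommGroup E] [NormedSpace ℝ E]
    {S : E × ℝ → ℝ} (hS : Differentiable ℝ S) (x : E) (ε : ℝ) :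
    deriv (fun e => S (x, e)) ε = fderiv ℝ S (x, ε) (0, 1) := by
  have h : HasFDerivAt (fun e => S (x, e)) _ ε :=
    (hS (x, ε)).hasFDerivAt.comp ε (hasFDerivAt_prodMk_right x ε)
  rw [← fderiv_apply_one_eq_deriv, h.fderiv]
  simp

/-- A limit of critical points of `S(·, ε)` as `ε → 0` is critical for `∂S/∂ε(·, 0)` in the
direction of a vector field along which `S(·, 0)` is constant. -/
lemma fderiv_deriv_slice_eq_zero_of_tendsto
    {E ι : Type*} [NormedAddCommGroup E] [NormedSpace ℝ E]
    {S : E × ℝ → ℝ} (hS : ContDiff ℝ 2 S) {x : E} {V : E → E} (hV : ContinuousAt V x)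
    (hV0 : ∀ᶠ y in 𝓝 x, fderiv ℝ (fun p => S (p, 0)) y (V y) = 0)
    {l : Filter ι} [l.NeBot] {y : ι → E} {ε : ι → ℝ}
    (hy : Tendsto y l (𝓝 x)) (hε : Tendsto ε l (𝓝 0)) (hε0 : ∀ i, ε i ≠ 0)
    (hcrit : ∀ i, fderiv ℝ (fun p => S (p, ε i)) (y i) = 0) :
    fderiv ℝ (fun z => deriv (fun e => S (z, e)) 0) x (V x) = 0 := by
  have hd : Differentiable ℝ S := hS.differentiable (by simp)
  have hF : ContDiff ℝ 1 (fderiv ℝ S) := hS.fderiv_right (by norm_num)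
  set B := fderiv ℝ (fderiv ℝ S) (x, 0)
  have hstrict : HasStrictFDerivAt (fderiv ℝ S) B (x, 0) :=
    hF.contDiffAt.hasStrictFDerivAt (by simp)
  have hsymm : B (V x, 0) (0, 1) = B (0, 1) (V x, 0) :=
    (hS.contDiffAt.isSymmSndFDerivAt (by simp)) _ _
  have hS₁ : fderiv ℝ (fun z => deriv (fun e => S (z, e)) 0) x (V x) = B (V x, 0) (0, 1) := by
    simp_rw [deriv_slice hd]
    have h : HasFDerivAt (fun z => fderiv ℝ S (z, 0) ((0, 1) : E × ℝ)) _ x :=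
      (hstrict.hasFDerivAt.comp x (hasFDerivAt_prodMk_left x (0 : ℝ))).clm_apply
        (hasFDerivAt_const ((0, 1) : E × ℝ) x)
    rw [h.fderiv]
    simp
  rw [hS₁, hsymm]
  have hpair : Tendsto (fun i => ((y i, ε i), (y i, (0 : ℝ)))) l (𝓝 ((x, 0), (x, 0))) :=
    (hy.prodMk_nhds hε).prodMk_nhds (hy.prodMk_nhds tendsto_const_nhds)
  have ho := hstrict.isLittleO.comp_tendsto hpair
  have hquot : Tendsto (fun i => (ε i)⁻¹ • (fderiv ℝ S (y i, ε i) - fderiv ℝ S (y i, 0)))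
      l (𝓝 (B (0, 1))) := by
    have ho' : (fun i => fderiv ℝ S (y i, ε i) - fderiv ℝ S (y i, 0) - B (0, ε i)) =o[l] ε := by
      refine (ho.congr_left fun i => by simp [-map_sub]).trans_isBigO ?_
      refine Asymptotics.IsBigO.of_bound 1 (Eventually.of_forall fun i => ?_)
      simp [Prod.norm_def]
    have h0 := ho'.tendsto_inv_smul_nhds_zero
    have h1 := h0.add_const (B (0, 1))
    rw [zero_add] at h1
    refine h1.congr fun i => ?_
    have : B (0, ε i) = ε i • B (0, 1) := by rw [← map_smul]; simp
    rw [this, smul_sub, smul_smul, inv_mul_cancel₀ (hε0 i), one_smul, sub_add_cancel]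
  have hVt : Tendsto (fun i => (V (y i), (0 : ℝ))) l (𝓝 (V x, 0)) :=
    (hV.tendsto.comp hy).prodMk_nhds tendsto_const_nhds
  refine tendsto_nhds_unique ((isBoundedBilinearMap_apply.continuous.tendsto _).comp (hquot.prodMk_nhds hVt)) (tendsto_const_nhds.congr' ?_)
  filter_upwards [hy.eventually hV0] with i hi
  have h1 := fderiv_slice_apply_s7 hd (y i) (ε i) (V (y i))
  rw [fderiv_slice_apply_s7 hd] at hi
  simp [hcrit i] at h1
  simp [hi, ← h1]

/-- Localisation of perturbed critical points.  If `S₀` is Morse–Bott (in the chart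
sense, with charts modelled on Euclidean spaces), `Z₁` (the critical locus of `S₁` restricted to
the critical manifold of `S₀`, described via kernels of the Hessian) is compact, and `ψ` is a
proper nonnegative continuous function, then for every `C > 0` and open `𝒰` with
`Z₁ ⊆ 𝒰 ⊆ {ψ < C}` there is `ε₀ > 0` so that, for `0 < |ε| ≤ ε₀`, every critical point of
`S(·,ε)` lies in `𝒰` or has `ψ > C`. -/
theorem stmt7
    {E : Type*} [NormedAddCommGroup E] [NormedSpace ℝ E] [FiniteDimensional ℝ E]
    (S : E × ℝ → ℝ) (hS : ContDiff ℝ (⊤ : ℕ∞) S)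
    (ψ : E → ℝ) (hψcont : Continuous ψ) (hψ0 : ∀ x, 0 ≤ ψ x)
    (hψproper : ∀ K : Set ℝ, IsCompact K → IsCompact (ψ ⁻¹' K))
    (S₀ S₁ : E → ℝ)
    (hS₀def : ∀ x, S₀ x = S (x, 0))
    (hS₁def : ∀ x, S₁ x = deriv (fun e => S (x, e)) 0)
    (hMorseBott : ∀ x : E, fderiv ℝ S₀ x = 0 →
      ∃ (n m : ℕ) (Ωx : Set E)
        (Ω' : Set (EuclideanSpace ℝ (Fin n) × EuclideanSpace ℝ (Fin m)))
        (φ : E → EuclideanSpace ℝ (Fin n) × EuclideanSpace ℝ (Fin m))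
        (φinv : EuclideanSpace ℝ (Fin n) × EuclideanSpace ℝ (Fin m) → E)
        (L : EuclideanSpace ℝ (Fin n) ≃ₗ[ℝ] EuclideanSpace ℝ (Fin n)) (c : ℝ),
        IsOpen Ωx ∧ x ∈ Ωx ∧ IsOpen Ω' ∧
        ContDiffOn ℝ (⊤ : ℕ∞) φ Ωx ∧ Set.MapsTo φ Ωx Ω' ∧
        ContDiffOn ℝ (⊤ : ℕ∞) φinv Ω' ∧ Set.MapsTo φinv Ω' Ωx ∧
        (∀ y ∈ Ωx, φinv (φ y) = y) ∧ (∀ p ∈ Ω', φ (φinv p) = p) ∧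
        (∀ a b, ⟪L a, b⟫ = ⟪a, L b⟫) ∧
        (∀ p ∈ Ω', S₀ (φinv p) = (1 / 2) * ⟪L p.1, p.1⟫ + c))
    (Z₁ : Set E)
    (hZ₁def : Z₁ = {x : E | fderiv ℝ S₀ x = 0 ∧
      ∀ v : E, fderiv ℝ (fderiv ℝ S₀) x v = 0 → fderiv ℝ S₁ x v = 0})
    (hZ₁cpt : IsCompact Z₁) :
    ∀ C : ℝ, 0 < C → ∀ 𝒰 : Set E, IsOpen 𝒰 → Z₁ ⊆ 𝒰 → 𝒰 ⊆ {x | ψ x < C} →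
      ∃ ε₀ : ℝ, 0 < ε₀ ∧
        ∀ ε : ℝ, 0 < |ε| → |ε| ≤ ε₀ →
          ∀ x : E, fderiv ℝ (fun p => S (p, ε)) x = 0 → x ∈ 𝒰 ∨ ψ x > C := by
  obtain rfl : S₀ = fun x => S (x, 0) := funext hS₀def
  obtain rfl : S₁ = fun x => deriv (fun e => S (x, e)) 0 := funext hS₁def
  have hS2 : ContDiff ℝ 2 S := contDiff_infty.1 hS 2
  have hd : Differentiable ℝ S := hS2.differentiable (by simp)
  intro C _ 𝒰 h𝒰 hZ𝒰 _
  by_contra! hcon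
  choose ε hε0 hεle y hcrit hy𝒰 hyC using fun k : ℕ =>
    hcon (1 / ((k : ℝ) + 1)) (by positivity)
  have hε : Tendsto ε atTop (𝓝 0) :=
    squeeze_zero_norm hεle tendsto_one_div_add_atTop_nhds_zero_nat
  obtain ⟨x, -, σ, hσ, hx⟩ := (hψproper (Set.Icc 0 C) isCompact_Icc).tendsto_subseq
    (fun k => (⟨hψ0 (y k), hyC k⟩ : y k ∈ ψ ⁻¹' Set.Icc 0 C))
  have hεσ : Tendsto (ε ∘ σ) atTop (𝓝 0) := hε.comp hσ.tendsto_atTop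
  have hx𝒰 : x ∉ 𝒰 :=
    h𝒰.isClosed_compl.mem_of_tendsto hx (Eventually.of_forall fun k => hy𝒰 (σ k))
  have hxcrit : fderiv ℝ (fun p => S (p, 0)) x = 0 := by
    ext v
    rw [fderiv_slice_apply_s7 hd]
    have hlim : Tendsto (fun k => fderiv ℝ S (y (σ k), ε (σ k)) (v, 0)) atTop
        (𝓝 (fderiv ℝ S (x, 0) (v, 0))) :=
      (((hS2.continuous_fderiv (by simp)).clm_apply continuous_const).tendsto (x, 0)).comp
        (hx.prodMk_nhds hεσ)
    refine tendsto_nhds_unique hlim (tendsto_const_nhds.congr fun k => ?_)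
    rw [← fderiv_slice_apply_s7 hd, hcrit]
  refine hx𝒰 (hZ𝒰 ?_)
  rw [hZ₁def]
  refine ⟨hxcrit, fun v hv => ?_⟩
  obtain ⟨n, m, Ωx, Ω', φ, φinv, L, c, hΩ, hxΩ, hΩ', hφ, hφm, hφinv, -, hleft, -, hL, hquad⟩ :=
    hMorseBott x hxcrit
  obtain ⟨V, hV, rfl, hV0⟩ := exists_field_of_mem_ker_hessian
    (hS2.comp (contDiff_id.prodMk contDiff_const)) hxcrit hΩ hxΩ hΩ'
    (hφ.of_le (by exact_mod_cast le_top)) hφm (contDiffOn_infty.1 hφinv 2)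
    hleft hL hquad hv
  exact fderiv_deriv_slice_eq_zero_of_tendsto hS2 hV hV0 hx hεσ
    (fun k => abs_pos.1 (hε0 (σ k))) fun k => hcrit (σ k)
end

section
/- Let Φ : ℝ → M₂(ℂ) be continuous with Φ(t)ᴴ = −Φ(t) and Tr Φ(t) = 0 for every t, and let ξ : ℝ → M₂(ℂ) be differentiable with ξ(0) = 1 and ξ'(t) = −i·Φ(t)·ξ(t) for all t. Let n ∈ ℕ and let A₁, …, A_n and Y₁, …, Y_n : ℝ → M₂(ℂ) be continuous, and suppose X : ℝ → M₂(ℂ) is differentiable with X(0) = 0 and X'(t) = −i·Φ(t)·X(t) − Σ_{i=1}^n A_i(t)·Y_i(t) for all t. Then for every t ≥ 0 one has ‖X(t)‖ ≤ 2 · exp( √2 · ∫₀ᵗ ‖Φ(x)‖ dx ) · Σ_{i=1}^n ∫₀ᵗ ‖A_i(x)‖·‖Y_i(x)‖ dx, where ‖·‖ denotes the Frobenius norm. (This is the paper's holonomy-derivative estimate with an explicit constant.) -/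
attribute [local instance]
  Matrix.frobeniusSeminormedAddCommGroup
  Matrix.frobeniusNormedAddCommGroup
  Matrix.frobeniusNormedSpace

/-- Grönwall's inequality with variable coefficients and zero initial value, in integral form. -/
theorem norm_le_exp_integral_mul_integral_of_norm_deriv_le
    {E : Type*} [NormedAddCommGroup E] [NormedSpace ℝ E]
    {f f' : ℝ → E} {φ g : ℝ → ℝ} (hφ : Continuous φ) (hg : Continuous g)
    (hφ0 : ∀ x, 0 ≤ φ x) (hg0 : ∀ x, 0 ≤ g x) (hf0 : f 0 = 0)
    (hf : ∀ x, HasDerivAt f (f' x) x) (hf' : ∀ x, ‖f' x‖ ≤ φ x * ‖f x‖ + g x)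
    {t : ℝ} (ht : 0 ≤ t) :
    ‖f t‖ ≤ Real.exp (∫ x in (0:ℝ)..t, φ x) * ∫ x in (0:ℝ)..t, g x := by
  have key : ∀ ε > 0, ‖f t‖ ≤
      Real.exp (∫ x in (0:ℝ)..t, φ x) * ((∫ x in (0:ℝ)..t, g x) + ε * t) := by
    intro ε hε
    have hB : ∀ s, HasDerivAt
        (fun s => Real.exp (∫ x in (0:ℝ)..s, φ x) * ((∫ x in (0:ℝ)..s, g x) + ε * s))
        (Real.exp (∫ x in (0:ℝ)..s, φ x) * φ s * ((∫ x in (0:ℝ)..s, g x) + ε * s) +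
          Real.exp (∫ x in (0:ℝ)..s, φ x) * (g s + ε * 1)) s := fun s =>
      (hφ.integral_hasStrictDerivAt 0 s).hasDerivAt.exp.mul
        ((hg.integral_hasStrictDerivAt 0 s).hasDerivAt.add ((hasDerivAt_id s).const_mul ε))
    refine image_norm_le_of_norm_deriv_right_lt_deriv_boundary (a := 0) (b := t)
      (fun x _ => (hf x).continuousAt.continuousWithinAt) (fun x _ => (hf x).hasDerivWithinAt)
      (by simp [hf0]) hB ?_ (Set.right_mem_Icc.2 ht)
    intro s hs heq
    have h1 := hf' s
    rw [heq] at h1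
    have h2 : 1 ≤ Real.exp (∫ x in (0:ℝ)..s, φ x) :=
      Real.one_le_exp (intervalIntegral.integral_nonneg hs.1 fun x _ => hφ0 x)
    nlinarith [mul_le_mul_of_nonneg_right h2 (hg0 s), mul_le_mul_of_nonneg_right h2 hε.le]
  have hlim : Filter.Tendsto
      (fun ε : ℝ => Real.exp (∫ x in (0:ℝ)..t, φ x) * ((∫ x in (0:ℝ)..t, g x) + ε * t))
      (nhdsWithin 0 (Set.Ioi 0))
      (nhds (Real.exp (∫ x in (0:ℝ)..t, φ x) * ∫ x in (0:ℝ)..t, g x)) := by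
    refine Filter.Tendsto.mono_left ?_ nhdsWithin_le_nhds
    refine Continuous.tendsto' (by fun_prop) _ _ (by simp)
  exact ge_of_tendsto hlim (Filter.eventually_of_mem self_mem_nhdsWithin key)

/-- the holonomy-derivative estimate with explicit constant: with `Φ` valued in
`𝔰𝔲(2)`, `ξ' = −iΦξ`, `ξ(0)=1`, and `X' = −iΦX − Σᵢ AᵢYᵢ`, `X(0)=0`, one has
`‖X(t)‖ ≤ 2 exp(√2 ∫₀ᵗ ‖Φ‖) · Σᵢ ∫₀ᵗ ‖Aᵢ‖‖Yᵢ‖` for `t ≥ 0` (Frobenius norms). -/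
theorem stmt11
    (Φ ξ : ℝ → Matrix (Fin 2) (Fin 2) ℂ)
    (hΦcont : Continuous Φ)
    (hΦskew : ∀ t, (Φ t).conjTranspose = -Φ t)
    (hΦtrace : ∀ t, (Φ t).trace = 0)
    (hξ0 : ξ 0 = 1)
    (hξ : ∀ t, HasDerivAt ξ (-(Complex.I • (Φ t * ξ t))) t)
    (n : ℕ) (A Y : Fin n → ℝ → Matrix (Fin 2) (Fin 2) ℂ)
    (hA : ∀ i, Continuous (A i)) (hY : ∀ i, Continuous (Y i))
    (X : ℝ → Matrix (Fin 2) (Fin 2) ℂ)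
    (hX0 : X 0 = 0)
    (hX : ∀ t, HasDerivAt X (-(Complex.I • (Φ t * X t)) - ∑ i, A i t * Y i t) t) :
    ∀ t : ℝ, 0 ≤ t →
      ‖X t‖ ≤ 2 * Real.exp (Real.sqrt 2 * ∫ x in (0:ℝ)..t, ‖Φ x‖) *
        ∑ i, ∫ x in (0:ℝ)..t, ‖A i x‖ * ‖Y i x‖ := by
  intro t ht
  have hΦn : Continuous fun x => ‖Φ x‖ := hΦcont.norm
  have hAY : ∀ i, Continuous fun x => ‖A i x‖ * ‖Y i x‖ := fun i =>
    (hA i).norm.mul (hY i).norm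
  have hbound : ∀ x, ‖-(Complex.I • (Φ x * X x)) - ∑ i, A i x * Y i x‖ ≤
      ‖Φ x‖ * ‖X x‖ + ∑ i, ‖A i x‖ * ‖Y i x‖ := by
    intro x
    refine (norm_sub_le _ _).trans (add_le_add ?_ ?_)
    · rw [norm_neg, norm_smul, Complex.norm_I, one_mul]
      exact Matrix.frobenius_norm_mul _ _
    · exact (norm_sum_le _ _).trans
        (Finset.sum_le_sum fun i _ => Matrix.frobenius_norm_mul _ _)
  have hgron := norm_le_exp_integral_mul_integral_of_norm_deriv_le hΦn
    (continuous_finsetSum _ fun i _ => hAY i) (fun x => norm_nonneg _)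
    (fun x => Finset.sum_nonneg fun i _ => by positivity) hX0 hX hbound ht
  rw [intervalIntegral.integral_finsetSum fun i _ => (hAY i).intervalIntegrable 0 t] at hgron
  have hP : 0 ≤ ∫ x in (0:ℝ)..t, ‖Φ x‖ :=
    intervalIntegral.integral_nonneg ht fun x _ => norm_nonneg _
  have hS : 0 ≤ ∑ i, ∫ x in (0:ℝ)..t, ‖A i x‖ * ‖Y i x‖ :=
    Finset.sum_nonneg fun i _ => intervalIntegral.integral_nonneg ht fun x _ => by positivity
  refine hgron.trans (mul_le_mul_of_nonneg_right ?_ hS)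
  have hexp : Real.exp (∫ x in (0:ℝ)..t, ‖Φ x‖) ≤
      Real.exp (Real.sqrt 2 * ∫ x in (0:ℝ)..t, ‖Φ x‖) :=
    Real.exp_le_exp.2 (le_mul_of_one_le_left hP (Real.one_le_sqrt.2 one_le_two))
  linarith [Real.exp_pos (Real.sqrt 2 * ∫ x in (0:ℝ)..t, ‖Φ x‖)]
end
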